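/- For every p ∈ [1, ∞] with dual exponent q (1/p + 1/q = 1), every ε ≥ 0, every θ, x ∈ ℝᵐ and y ∈ ℝ, there exists δ ∈ ℝᵐ with ‖δ‖_p ≤ ε such that |y − ⟨x + δ, θ⟩| = |y − ⟨x, θ⟩| + ε·‖θ‖_q. -/

import Mathlib

open scoped Matrix ENNReal

/-- The `ℓ_p` norm of a vector in `ℝᵐ`, via Mathlib's `PiLp` norm. -/
noncomputable def lpNorm {m : ℕ} (p : ℝ≥0∞) (x : Fin m → ℝ) : ℝ :=
  ‖(WithLp.equiv p (Fin m → ℝ)).symm x‖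

/-- Every vector is normed by some element of the closed dual unit ball. -/
theorem exists_lpNorm_le_one_dotProduct_eq {m : ℕ} (hm : 0 < m) (p q : ℝ≥0∞)
    [p.HolderConjugate q] (θ : Fin m → ℝ) :
    ∃ g : Fin m → ℝ, lpNorm p g ≤ 1 ∧ g ⬝ᵥ θ = lpNorm q θ := by
  have : Nonempty (Fin m) := ⟨⟨0, hm⟩⟩
  have sign_mul (t : ℝ) : (SignType.sign t : ℝ) * t = |t| := sign_mul_self t
  have abs_sign_le (t : ℝ) : |(SignType.sign t : ℝ)| ≤ 1 := by
    rcases lt_trichotomy t 0 with h | h | h <;> simp [h]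
  by_cases hp : p = ∞
  · subst hp
    obtain rfl : q = 1 := ENNReal.HolderConjugate.unique ∞ q 1
    refine ⟨fun i ↦ SignType.sign (θ i), ?_, ?_⟩
    · simp only [lpNorm, PiLp.norm_eq_ciSup]
      exact ciSup_le fun i ↦ abs_sign_le _
    · simp [lpNorm, PiLp.norm_eq_of_L1, dotProduct, sign_mul]
  by_cases hq : q = ∞
  · subst hq
    obtain rfl : p = 1 := ENNReal.HolderConjugate.unique ∞ p 1
    obtain ⟨i, hi⟩ := exists_eq_ciSup_of_finite (f := fun i ↦ |θ i|)
    refine ⟨Pi.single i (SignType.sign (θ i) : ℝ), ?_, ?_⟩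
    · have h : lpNorm 1 (Pi.single i (SignType.sign (θ i) : ℝ)) = |(SignType.sign (θ i) : ℝ)| :=
        PiLp.norm_single 1 (fun _ : Fin m ↦ ℝ) i _
      exact h.trans_le (abs_sign_le _)
    · rw [single_dotProduct, sign_mul, hi]
      simp [lpNorm, PiLp.norm_eq_ciSup]
  have hr : p.toReal.HolderConjugate q.toReal := ENNReal.HolderConjugate.toReal_of_ne_top hp hq
  obtain ⟨φ, hφ, hφθ⟩ := (NNReal.isGreatest_Lp Finset.univ (fun i ↦ ‖θ i‖₊) hr.symm).1
  refine ⟨fun i ↦ SignType.sign (θ i) * φ i, ?_, ?_⟩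
  · simp only [lpNorm, PiLp.norm_eq_sum hr.pos]
    refine Real.rpow_le_one (by positivity) ?_ (by have := hr.pos; positivity)
    have hφ' : ∑ i, (φ i : ℝ) ^ p.toReal ≤ 1 := by exact_mod_cast hφ
    refine le_trans (Finset.sum_le_sum fun i _ ↦ ?_) hφ'
    refine Real.rpow_le_rpow (norm_nonneg _) ?_ hr.nonneg
    have := mul_le_mul_of_nonneg_right (abs_sign_le (θ i)) (φ i).2
    simpa [abs_mul] using this
  · have h := congrArg NNReal.toReal hφθ
    push_cast at h
    simp only [lpNorm, PiLp.norm_eq_sum hr.symm.pos]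
    refine Eq.trans (Finset.sum_congr rfl fun i _ ↦ ?_) h
    rw [Real.norm_eq_abs, ← sign_mul]
    ring

/-- For `p ∈ [1,∞]` with dual exponent `q`, `ε ≥ 0`, `θ, x ∈ ℝᵐ` and `y ∈ ℝ`, there is a
perturbation `δ` with `‖δ‖_p ≤ ε` such that `|y − ⟨x + δ, θ⟩| = |y − ⟨x, θ⟩| + ε·‖θ‖_q`. -/
theorem adv_abs_attained {m : ℕ} (hm : 0 < m) (p q : ℝ≥0∞) (hp : 1 ≤ p)
    (hpq : 1 / p + 1 / q = 1) (ε : ℝ) (hε : 0 ≤ ε) (θ x : Fin m → ℝ) (y : ℝ) :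
    ∃ δ : Fin m → ℝ, lpNorm p δ ≤ ε ∧
      |y - (x + δ) ⬝ᵥ θ| = |y - x ⬝ᵥ θ| + ε * lpNorm q θ := by
  have : Fact (1 ≤ p) := ⟨hp⟩
  have hc : p.HolderConjugate q := ENNReal.holderConjugate_iff.2 (by simpa using hpq)
  have : Fact (1 ≤ q) := ⟨ENNReal.HolderConjugate.one_le q p⟩
  obtain ⟨g, hg, hgθ⟩ := exists_lpNorm_le_one_dotProduct_eq hm p q θ
  have lpNorm_smul (c : ℝ) : lpNorm p (c • g) = |c| * lpNorm p g :=
    norm_smul c (WithLp.toLp p g)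
  have hN : 0 ≤ ε * lpNorm q θ := mul_nonneg hε (norm_nonneg _)
  rcases le_total 0 (y - x ⬝ᵥ θ) with h | h
  · refine ⟨(-ε) • g, ?_, ?_⟩
    · rw [lpNorm_smul, abs_neg, abs_of_nonneg hε]
      exact mul_le_of_le_one_right hε hg
    · rw [add_dotProduct, smul_dotProduct, hgθ, smul_eq_mul, abs_of_nonneg h,
        abs_of_nonneg (by linarith)]
      ring
  · refine ⟨ε • g, ?_, ?_⟩
    · rw [lpNorm_smul, abs_of_nonneg hε]
      exact mul_le_of_le_one_right hε hg
    · rw [add_dotProduct, smul_dotProduct, hgθ, smul_eq_mul, abs_of_nonpos h,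
        abs_of_nonpos (by linarith)]
      ring
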